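/- Let G = ⟨a,b_1,…,b_r⟩ be a multi-GGS-group, and for n ∈ ℕ let Ḡ_n denote the quotient of G_n = G/st_G(n) by its commutator subgroup. Then for every n with 2 ≤ n ≤ r+1, the minimal number of generators of Ḡ_n is at least n. -/

import Mathlib

/-!
Automorphisms of the `p`-regular rooted tree, encoded by portraits:
an automorphism is a family of permutations of `Fin p`, one for each vertex
(vertices are finite words over `Fin p`, the root being `[]`).
-/

namespace TreeAut

variable {p : ℕ}

/-- Automorphisms of the `p`-regular rooted tree, given by their portraits. -/
def AutT (p : ℕ) : Type := List (Fin p) → Equiv.Perm (Fin p)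

namespace AutT

/-- The action of a tree automorphism on the vertices (finite words over `Fin p`). -/
def act : AutT p → List (Fin p) → List (Fin p)
  | _, [] => []
  | f, x :: w => f [] x :: act (fun v => f (x :: v)) w

/-- The section of `f` at the level-one vertex `x`; the map
`f ↦ (sections f 0, …, sections f (p-1))` restricted to the first-level
stabilizer is the isomorphism `ψ`. -/
def sections (f : AutT p) : Fin p → AutT p := fun x v => f (x :: v)

instance : One (AutT p) := ⟨fun _ => 1⟩

instance : Mul (AutT p) := ⟨fun f g v => f (act g v) * g v⟩

/-- The action of the inverse automorphism on vertices. -/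
def invAct : AutT p → List (Fin p) → List (Fin p)
  | _, [] => []
  | f, x :: w => (f [])⁻¹ x :: invAct (fun v => f (((f [])⁻¹ x) :: v)) w

instance : Inv (AutT p) := ⟨fun f v => (f (invAct f v))⁻¹⟩

lemma one_apply (v : List (Fin p)) : (1 : AutT p) v = 1 := rfl

lemma mul_apply (f g : AutT p) (v : List (Fin p)) : (f * g) v = f (act g v) * g v := rfl

lemma inv_apply (f : AutT p) (v : List (Fin p)) : f⁻¹ v = (f (invAct f v))⁻¹ := rfl

lemma act_nil (f : AutT p) : act f [] = [] := rfl

lemma act_cons (f : AutT p) (x : Fin p) (w : List (Fin p)) :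
    act f (x :: w) = f [] x :: act (sections f x) w := rfl

lemma sections_mul (f g : AutT p) (x : Fin p) :
    sections (f * g) x = sections f (g [] x) * sections g x :=
  funext fun _ => rfl

lemma act_one : ∀ v : List (Fin p), act (1 : AutT p) v = v
  | [] => rfl
  | x :: w => congrArg (x :: ·) (act_one w)

lemma act_mul (f g : AutT p) : ∀ v : List (Fin p), act (f * g) v = act f (act g v)
  | [] => rfl
  | x :: w => by
      rw [act_cons (f * g), sections_mul, act_mul, act_cons g, act_cons f]
      rfl

lemma invAct_act (f : AutT p) : ∀ v : List (Fin p), invAct f (act f v) = v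
  | [] => rfl
  | x :: w => by
      rw [act_cons]
      show (f [])⁻¹ (f [] x) ::
          invAct (fun v => f (((f [])⁻¹ (f [] x)) :: v)) (act (sections f x) w) = x :: w
      have h : (f [])⁻¹ (f [] x) = x := Equiv.symm_apply_apply (f []) x
      refine (congrArg (fun y : Fin p =>
        y :: invAct (fun v => f (y :: v)) (act (sections f x) w)) h).trans ?_
      exact congrArg (x :: ·) (invAct_act (sections f x) w)

instance : Group (AutT p) where
  mul_assoc f g h := by
    funext v
    show (f * g) (act h v) * h v = f (act (g * h) v) * (g * h) v
    rw [mul_apply, mul_apply, act_mul, mul_assoc]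
  one_mul f := by
    funext v
    show (1 : AutT p) (act f v) * f v = f v
    rw [one_apply, one_mul]
  mul_one f := by
    funext v
    show f (act (1 : AutT p) v) * (1 : AutT p) v = f v
    rw [act_one, one_apply, mul_one]
  inv_mul_cancel f := by
    funext v
    show f⁻¹ (act f v) * f v = (1 : AutT p) v
    rw [inv_apply, invAct_act, one_apply, inv_mul_cancel]

lemma act_length (f : AutT p) : ∀ v : List (Fin p), (act f v).length = v.length
  | [] => rfl
  | _ :: w => congrArg Nat.succ (act_length _ w)

lemma act_act_inv (f : AutT p) (v : List (Fin p)) : act f (act f⁻¹ v) = v := by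
  rw [← act_mul, mul_inv_cancel, act_one]

/-- The pointwise stabilizer `st(n)` of the `n`-th level of the tree. -/
def levelStab (p n : ℕ) : Subgroup (AutT p) where
  carrier := {f | ∀ v : List (Fin p), v.length = n → act f v = v}
  one_mem' := fun v _ => act_one v
  mul_mem' := by
    intro f g hf hg v hv
    rw [act_mul, hg v hv, hf v hv]
  inv_mem' := by
    intro f hf v hv
    have h1 : act f (act f⁻¹ v) = v := act_act_inv f v
    have h2 : act f (act f⁻¹ v) = act f⁻¹ v := hf _ (by rw [act_length, hv])
    exact h2.symm.trans h1

instance levelStab_normal (p n : ℕ) : (levelStab p n).Normal := by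
  constructor
  intro f hf g v hv
  show act (g * f * g⁻¹) v = v
  rw [act_mul, act_mul, hf _ (by rw [act_length, hv]), act_act_inv]

/-- The tuple of sections at the level-two vertices.  Restricted to the
second-level stabilizer this is the map `ψ₂`. -/
def sections2 (f : AutT p) : Fin p → Fin p → AutT p := fun x y v => f (x :: y :: v)

/-- The rooted automorphism defined by a permutation `σ` of `Fin p`. -/
def rooted (σ : Equiv.Perm (Fin p)) : AutT p := fun v => if v = [] then σ else 1

/-- The rooted automorphism `a`, acting at the root by the cycle `(1 2 … p)`. -/
def rootedA (p : ℕ) : AutT p := rooted (finRotate p)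

/-- Auxiliary portrait for the directed automorphism `b_e`. -/
def directedAux (e : Fin (p - 1) → ZMod p) : List (Fin p) → Equiv.Perm (Fin p)
  | [] => 1
  | x :: w =>
      if h : (x : ℕ) < p - 1 then
        (if w = [] then finRotate p ^ ((e ⟨x, h⟩).val) else 1)
      else directedAux e w

/-- The directed automorphism `b_e` defined by the vector `e ∈ 𝔽_p^{p-1}`,
i.e. the unique automorphism with `ψ(b_e) = (a^{e_1}, …, a^{e_{p-1}}, b_e)`. -/
def directed (e : Fin (p - 1) → ZMod p) : AutT p := directedAux e

/-- The multi-GGS-group determined by the vectors `e 1, …, e r`. -/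
def multiGGS (p : ℕ) {r : ℕ} (e : Fin r → Fin (p - 1) → ZMod p) : Subgroup (AutT p) :=
  Subgroup.closure ({rootedA p} ∪ Set.range fun i => directed (e i))

/-- The GGS-group `𝒢` defined by the (nonzero) constant vector `(c, …, c)`. -/
def constGGS (p : ℕ) (c : ZMod p) : Subgroup (AutT p) :=
  Subgroup.closure {rootedA p, directed (fun _ => c)}

/-- `G` is the GGS-group `𝒢` defined by a constant vector. -/
def IsConstGGS {p : ℕ} (G : Subgroup (AutT p)) : Prop :=
  ∃ c : ZMod p, c ≠ 0 ∧ G = constGGS p c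

/-- The stabilizer `st_G(n) = G ∩ st(n)`, viewed as a subgroup of `G`. -/
def stabIn {p : ℕ} (G : Subgroup (AutT p)) (n : ℕ) : Subgroup G :=
  (levelStab p n).comap G.subtype

instance {p : ℕ} (G : Subgroup (AutT p)) (n : ℕ) : (stabIn G n).Normal :=
  Subgroup.Normal.comap (levelStab_normal p n) G.subtype

/-- The congruence subgroup property: every finite-index subgroup of `G`
contains a level stabilizer `st_G(n)`. -/
def HasCSP {p : ℕ} (G : Subgroup (AutT p)) : Prop :=
  ∀ H : Subgroup G, H.FiniteIndex → ∃ n : ℕ, stabIn G n ≤ H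

/-- `G` is just infinite: it is infinite and all its nontrivial normal
subgroups have finite index. -/
def JustInfinite {p : ℕ} (G : Subgroup (AutT p)) : Prop :=
  Infinite G ∧ ∀ N : Subgroup G, N.Normal → N ≠ ⊥ → N.FiniteIndex

end AutT

end TreeAut

open TreeAut AutT Subgroup

namespace TreeAut.AutT

section Translation

variable {p : ℕ}

/-- Translation by `c` on functions `Fin p → ZMod p`. -/
def translation (c : Fin p) : Module.End (ZMod p) (Fin p → ZMod p) :=
  LinearMap.funLeft (ZMod p) (ZMod p) (· + c)

lemma translation_apply (c : Fin p) (s : Fin p → ZMod p) (x : Fin p) :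
    translation c s x = s (x + c) := rfl

lemma translation_commute (c d : Fin p) : Commute (translation c) (translation d) := by
  refine LinearMap.ext fun s => funext fun x => ?_
  simp only [Module.End.mul_apply, translation_apply]
  rw [add_right_comm]

variable [NeZero p]

/-- The forward difference operator. -/
def diff (p : ℕ) [NeZero p] : Module.End (ZMod p) (Fin p → ZMod p) := translation 1 - 1

lemma translation_commute_diff_pow (c : Fin p) (m : ℕ) :
    Commute (translation c) (diff p ^ m) :=
  ((translation_commute c 1).sub_right (Commute.one_right _)).pow_right m

lemma translation_eq_self_of_diff_eq_zero {s : Fin p → ZMod p} (hs : diff p s = 0)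
    (c : Fin p) : translation c s = s := by
  have h1 : ∀ x, s (x + 1) = s x := fun x => sub_eq_zero.1 (congrFun hs x)
  have h2 : ∀ k : ℕ, ∀ x, s (x + Fin.ofNat p k) = s x := by
    intro k
    induction k with
    | zero => intro x; congr 1; ext; simp
    | succ k ih =>
      intro x
      rw [← ih x, ← h1 (x + Fin.ofNat p k)]
      congr 1
      ext
      simp [Fin.val_add, add_assoc]
  funext x
  have := h2 c.val x
  rwa [Fin.ofNat_val_eq_self] at this

lemma translation_one_pow_apply (k : ℕ) (s : Fin p → ZMod p) (x : Fin p) :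
    (translation 1 ^ k) s x = s (x + Fin.ofNat p k) := by
  induction k generalizing x with
  | zero => rw [pow_zero, Module.End.one_apply]; congr 1; ext; simp
  | succ k ih =>
    rw [pow_succ', Module.End.mul_apply, translation_apply, ih]
    congr 1
    ext
    simp [Fin.val_add, add_assoc, add_comm 1 k]

lemma diff_pow_prime [hp : Fact p.Prime] : diff p ^ p = 0 := by
  have : CharP (Module.End (ZMod p) (Fin p → ZMod p)) p :=
    charP_of_injective_algebraMap
      (FaithfulSMul.algebraMap_injective (ZMod p) (Module.End (ZMod p) (Fin p → ZMod p))) p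
  rw [diff, sub_pow_char_of_commute _ (Commute.one_right _), one_pow, sub_eq_zero]
  refine LinearMap.ext fun s => funext fun x => ?_
  rw [translation_one_pow_apply, Module.End.one_apply]
  congr 1
  ext
  simp

end Translation

section Convolution

variable {p r : ℕ} (e : Fin r → Fin (p - 1) → ZMod p)

/-- The linear map sending `β` to `∑ β_j e_j`, extended by `0` to all of `Fin p`. -/
def labels : (Fin r → ZMod p) →ₗ[ZMod p] (Fin p → ZMod p) :=
  LinearMap.pi fun x =>
    if h : (x : ℕ) < p - 1 then
      (LinearMap.proj ⟨x, h⟩).comp (Fintype.linearCombination (ZMod p) e)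
    else 0

lemma labels_of_lt (β : Fin r → ZMod p) {x : Fin p} (h : (x : ℕ) < p - 1) :
    labels e β x = Fintype.linearCombination (ZMod p) e β ⟨x, h⟩ := by
  simp [labels, h]

lemma labels_of_not_lt (β : Fin r → ZMod p) {x : Fin p} (h : ¬ (x : ℕ) < p - 1) :
    labels e β x = 0 := by
  simp [labels, h]

lemma labels_injective (he : LinearIndependent (ZMod p) e) :
    Function.Injective (labels e) := by
  refine (injective_iff_map_eq_zero _).2 fun β hβ => ?_
  have h : Fintype.linearCombination (ZMod p) e β = 0 := by
    funext x
    have hx := labels_of_lt e β (x := ⟨x, by omega⟩) x.2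
    rw [hβ] at hx
    exact hx.symm
  exact funext (Fintype.linearIndependent_iff.1 he β h)

variable [NeZero p]

/-- The level-one labels of an element whose section at `y` has `b`-exponents `B y`. -/
def conv : (Fin p → Fin r → ZMod p) →ₗ[ZMod p] (Fin p → ZMod p) :=
  ∑ y, (translation (-1 - y)).comp ((labels e).comp (LinearMap.proj y))

lemma conv_apply (B : Fin p → Fin r → ZMod p) :
    conv e B = ∑ y, translation (-1 - y) (labels e (B y)) := by
  simp [conv]

lemma conv_single (β : Fin r → ZMod p) : conv e (Pi.single (-1) β) = labels e β := by
  rw [conv_apply, Finset.sum_eq_single (-1)]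
  · funext x
    simp [translation_apply]
  · intro y _ hy
    simp [Pi.single_eq_of_ne hy]
  · simp

/-- The permutations of the first level which commute with `conv`. -/
def convPerm : Subgroup (Equiv.Perm (Fin p)) where
  carrier := {σ | ∀ B, conv e (B ∘ σ) = conv e B ∘ σ}
  one_mem' := fun _ => rfl
  mul_mem' := by
    intro σ τ hσ hτ B
    have := hτ (B ∘ σ)
    rw [hσ] at this
    exact this
  inv_mem' := by
    intro σ hσ B
    have := hσ (B ∘ ⇑σ⁻¹)
    have h1 : (B ∘ ⇑σ⁻¹) ∘ ⇑σ = B := by funext x; simp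
    rw [h1] at this
    rw [this]
    funext x
    simp

lemma finRotate_mem_convPerm : finRotate p ∈ convPerm e := by
  intro B
  rw [conv_apply, conv_apply]
  funext x
  simp only [Finset.sum_apply, Function.comp_apply, translation_apply, finRotate_apply]
  refine Fintype.sum_equiv (Equiv.addRight 1) _ _ fun y => ?_
  simp only [Equiv.coe_addRight]
  rw [show x + (-1 - y) = x + 1 + (-1 - (y + 1)) by abel]

lemma conv_comp_zpow (B : Fin p → Fin r → ZMod p) (k : ℤ) :
    conv e (B ∘ ⇑(finRotate p ^ k)) = conv e B ∘ ⇑(finRotate p ^ k) :=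
  zpow_mem (finRotate_mem_convPerm e) k B

/-- If `conv` kills a family of vectors of `W`, the sum of the family is killed by any
`diff ^ m ∘ labels` with `diff ^ (m + 1) ∘ labels` vanishing on `W`. -/
lemma diff_pow_labels_sum {W : Submodule (ZMod p) (Fin r → ZMod p)} {m : ℕ}
    (hW : ∀ w ∈ W, (diff p ^ (m + 1)) (labels e w) = 0)
    {B : Fin p → Fin r → ZMod p} (hB : ∀ y, B y ∈ W) (h0 : conv e B = 0) :
    (diff p ^ m) (labels e (∑ y, B y)) = 0 := by
  rw [map_sum, map_sum, ← map_zero (diff p ^ m), ← h0, conv_apply, map_sum]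
  refine Finset.sum_congr rfl fun y _ => ?_
  rw [← Module.End.mul_apply (diff p ^ m) (translation _),
    ← (translation_commute_diff_pow _ m).eq, Module.End.mul_apply]
  refine (translation_eq_self_of_diff_eq_zero ?_ _).symm
  rw [← Module.End.mul_apply, ← pow_succ']
  exact hW _ (hB y)

/-- A nonzero space of exponents has a proper subspace containing the sum of every family
in it which is killed by `conv`. -/
lemma exists_lt_sum_mem [Fact p.Prime] (he : LinearIndependent (ZMod p) e)
    {W : Submodule (ZMod p) (Fin r → ZMod p)} (hW : W ≠ ⊥) :
    ∃ W' < W, ∀ B : Fin p → Fin r → ZMod p, (∀ y, B y ∈ W) → conv e B = 0 →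
      ∑ y, B y ∈ W' := by
  classical
  have hex : ∃ m, ∀ w ∈ W, (diff p ^ m) (labels e w) = 0 :=
    ⟨p, fun w _ => by rw [diff_pow_prime]; rfl⟩
  obtain ⟨m, hm⟩ : ∃ m, Nat.find hex = m + 1 := by
    refine Nat.exists_eq_succ_of_ne_zero fun h => hW ?_
    have := Nat.find_spec hex
    rw [h] at this
    refine (Submodule.eq_bot_iff _).2 fun w hw => ?_
    exact (injective_iff_map_eq_zero _).1 (labels_injective e he) w (by simpa using this w hw)
  refine ⟨W ⊓ LinearMap.ker ((diff p ^ m).comp (labels e)), ?_, fun B hB h0 => ?_⟩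
  · refine inf_lt_left.2 fun hle => ?_
    exact Nat.find_min hex (m := m) (by omega) fun w hw => hle hw
  · refine ⟨sum_mem fun y _ => hB y, ?_⟩
    have hspec := Nat.find_spec hex
    rw [hm] at hspec
    exact diff_pow_labels_sum e hspec hB h0

end Convolution

section Exponents

variable {p r : ℕ} (e : Fin r → Fin (p - 1) → ZMod p)

/-- The pairs consisting of an element of the multi-GGS-group and the exponent sums
(of `a`, and of the `b_j`) of some word representing it. -/
def exponentGraph :
    Subgroup (AutT p × Multiplicative (ZMod p × (Fin r → ZMod p))) :=
  Subgroup.closure ({(rootedA p, Multiplicative.ofAdd (1, 0))} ∪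
    Set.range fun j => (directed (e j), Multiplicative.ofAdd (0, Pi.single j 1)))

/-- `g` is represented by a word with exponent sums `α` of `a` and `β` of the `b_j`. -/
def HasExponents (g : AutT p) (α : ZMod p) (β : Fin r → ZMod p) : Prop :=
  (g, Multiplicative.ofAdd (α, β)) ∈ exponentGraph e

variable {e}

lemma HasExponents.one : HasExponents e 1 0 0 := one_mem (exponentGraph e)

lemma HasExponents.mul {g g' : AutT p} {α α' : ZMod p} {β β' : Fin r → ZMod p}
    (h : HasExponents e g α β) (h' : HasExponents e g' α' β') :
    HasExponents e (g * g') (α + α') (β + β') := mul_mem h h'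

lemma HasExponents.inv {g : AutT p} {α : ZMod p} {β : Fin r → ZMod p}
    (h : HasExponents e g α β) : HasExponents e g⁻¹ (-α) (-β) := inv_mem h

lemma HasExponents.rootedA : HasExponents e (rootedA p) 1 0 :=
  Subgroup.subset_closure (Or.inl rfl)

lemma HasExponents.directed (j : Fin r) :
    HasExponents e (directed (e j)) 0 (Pi.single j 1) :=
  Subgroup.subset_closure (Or.inr ⟨j, rfl⟩)

lemma HasExponents.pow {g : AutT p} {α : ZMod p} {β : Fin r → ZMod p}
    (h : HasExponents e g α β) (k : ℕ) : HasExponents e (g ^ k) (k • α) (k • β) :=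
  pow_mem h k

lemma HasExponents.rootedA_pow (k : ℕ) : HasExponents e (AutT.rootedA p ^ k) k 0 := by
  simpa using (HasExponents.rootedA (e := e)).pow k

/-- Every vector is the vector of exponents of some element. -/
lemma exists_hasExponents_of_exponents [NeZero p] (α : ZMod p) (β : Fin r → ZMod p) :
    ∃ g, HasExponents e g α β := by
  have hβ : ∃ g, HasExponents e g 0 β := by
    rw [← Finset.univ_sum_single β]
    refine Finset.sum_induction _ (fun β => ∃ g, HasExponents e g 0 β) ?_ ⟨1, .one⟩ ?_
    · rintro β β' ⟨g, h⟩ ⟨g', h'⟩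
      exact ⟨g * g', by simpa using h.mul h'⟩
    · intro j _
      refine ⟨AutT.directed (e j) ^ (β j).val, ?_⟩
      simpa [← Pi.single_smul] using (HasExponents.directed (e := e) j).pow (β j).val
  obtain ⟨g, hg⟩ := hβ
  exact ⟨_, by simpa using (HasExponents.rootedA_pow α.val).mul hg⟩

lemma HasExponents.induction
    {P : AutT p → ZMod p → (Fin r → ZMod p) → Prop}
    (hone : P 1 0 0) (ha : P (AutT.rootedA p) 1 0)
    (hb : ∀ j, P (AutT.directed (e j)) 0 (Pi.single j 1))
    (hmul : ∀ g α β g' α' β', P g α β → P g' α' β' → P (g * g') (α + α') (β + β'))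
    (hinv : ∀ g α β, P g α β → P g⁻¹ (-α) (-β))
    {g : AutT p} {α : ZMod p} {β : Fin r → ZMod p} (h : HasExponents e g α β) : P g α β := by
  refine Subgroup.closure_induction
    (p := fun z _ => P z.1 z.2.toAdd.1 z.2.toAdd.2) ?_ hone ?_ ?_ h
  · rintro z (rfl | ⟨j, rfl⟩)
    · exact ha
    · exact hb j
  · intro z z' _ _ hz hz'
    exact hmul _ _ _ _ _ _ hz hz'
  · intro z _ hz
    exact hinv _ _ _ hz

lemma exists_hasExponents {g : AutT p} (hg : g ∈ multiGGS p e) :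
    ∃ α β, HasExponents e g α β := by
  refine Subgroup.closure_induction (p := fun g _ => ∃ α β, HasExponents e g α β)
    ?_ ⟨0, 0, .one⟩ ?_ ?_ hg
  · rintro g (rfl | ⟨j, rfl⟩)
    · exact ⟨_, _, .rootedA⟩
    · exact ⟨_, _, .directed j⟩
  · rintro g g' _ _ ⟨α, β, h⟩ ⟨α', β', h'⟩
    exact ⟨_, _, h.mul h'⟩
  · rintro g _ ⟨α, β, h⟩
    exact ⟨_, _, h.inv⟩

lemma HasExponents.mem {g : AutT p} {α : ZMod p} {β : Fin r → ZMod p}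
    (h : HasExponents e g α β) : g ∈ multiGGS p e :=
  h.induction (P := fun g _ _ => g ∈ multiGGS p e) (one_mem _)
    (Subgroup.subset_closure (Or.inl rfl))
    (fun j => Subgroup.subset_closure (Or.inr ⟨j, rfl⟩))
    (fun _ _ _ _ _ _ h h' => mul_mem h h') (fun _ _ _ h => inv_mem h)

lemma rooted_one : rooted (1 : Equiv.Perm (Fin p)) = 1 := by
  funext v
  simp [rooted, one_apply]

lemma rooted_mul (σ τ : Equiv.Perm (Fin p)) : rooted (σ * τ) = rooted σ * rooted τ := by
  funext v
  cases v with
  | nil => rfl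
  | cons x w => simp [rooted, mul_apply, act_cons]

lemma rooted_pow (σ : Equiv.Perm (Fin p)) (k : ℕ) : rooted (σ ^ k) = rooted σ ^ k := by
  induction k with
  | zero => exact rooted_one
  | succ k ih => rw [pow_succ, rooted_mul, ih, pow_succ]

lemma sections_rooted (σ : Equiv.Perm (Fin p)) (x : Fin p) : sections (rooted σ) x = 1 := by
  funext v
  simp [sections, rooted, one_apply]

lemma sections_directed_of_lt (v : Fin (p - 1) → ZMod p) {x : Fin p} (h : (x : ℕ) < p - 1) :
    sections (directed v) x = rootedA p ^ (v ⟨x, h⟩).val := by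
  rw [rootedA, ← rooted_pow]
  funext w
  simp [sections, directed, directedAux, rooted, h]

lemma sections_directed_of_not_lt (v : Fin (p - 1) → ZMod p) {x : Fin p}
    (h : ¬ (x : ℕ) < p - 1) : sections (directed v) x = directed v := by
  funext w
  simp [sections, directed, directedAux, h]

lemma sections_inv (g : AutT p) (x : Fin p) :
    sections g⁻¹ x = (sections g ((g [])⁻¹ x))⁻¹ := by
  have h := sections_mul g g⁻¹ x
  rw [mul_inv_cancel] at h
  exact (inv_eq_of_mul_eq_one_right h.symm).symm

/-- The exponents of the sections of an element determine its own exponents. -/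
lemma HasExponents.exists_sections [NeZero p] {g : AutT p} {α : ZMod p}
    {β : Fin r → ZMod p} (h : HasExponents e g α β) :
    ∃ (k : ℤ) (B : Fin p → Fin r → ZMod p), g [] = finRotate p ^ k ∧ (k : ZMod p) = α ∧
      ∑ y, B y = β ∧ ∀ x, HasExponents e (sections g x) (conv e B x) (B x) := by
  refine h.induction (P := fun g α β =>
    ∃ (k : ℤ) (B : Fin p → Fin r → ZMod p), g [] = finRotate p ^ k ∧ (k : ZMod p) = α ∧
      ∑ y, B y = β ∧ ∀ x, HasExponents e (sections g x) (conv e B x) (B x))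
    ?_ ?_ ?_ ?_ ?_
  · refine ⟨0, 0, by simp [one_apply], by simp, by simp, fun x => ?_⟩
    rw [map_zero]
    exact .one
  · refine ⟨1, 0, by simp [AutT.rootedA, rooted], by simp, by simp, fun x => ?_⟩
    rw [map_zero, AutT.rootedA, sections_rooted]
    exact .one
  · intro j
    refine ⟨0, Pi.single (-1) (Pi.single j 1), rfl, by simp, by simp, fun x => ?_⟩
    rw [conv_single]
    by_cases hx : (x : ℕ) < p - 1
    · have hne : x ≠ -1 := by
        rintro rfl
        revert hx
        obtain ⟨q, rfl⟩ := Nat.exists_eq_succ_of_ne_zero (NeZero.ne p)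
        simp [Fin.coe_neg_one]
      rw [sections_directed_of_lt _ hx, Pi.single_eq_of_ne hne, labels_of_lt e _ hx]
      simpa using HasExponents.rootedA_pow (e := e) (e j ⟨x, hx⟩).val
    · have heq : x = -1 := by
        obtain ⟨q, rfl⟩ := Nat.exists_eq_succ_of_ne_zero (NeZero.ne p)
        ext
        simp only [Nat.succ_eq_add_one, Fin.coe_neg_one]
        omega
      rw [sections_directed_of_not_lt _ hx, labels_of_not_lt e _ hx, heq, Pi.single_eq_same]
      exact .directed j
  · rintro g α β g' α' β' ⟨k, B, hg, rfl, rfl, hs⟩ ⟨k', B', hg', rfl, rfl, hs'⟩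
    refine ⟨k + k', B ∘ ⇑(finRotate p ^ k') + B', ?_, by push_cast; rfl, ?_, fun x => ?_⟩
    · rw [mul_apply, act_nil, hg, hg', zpow_add]
    · simp only [Pi.add_apply, Finset.sum_add_distrib, Function.comp_apply]
      rw [Equiv.sum_comp]
    · rw [map_add, conv_comp_zpow, sections_mul, hg']
      exact (hs _).mul (hs' x)
  · rintro g α β ⟨k, B, hg, rfl, rfl, hs⟩
    refine ⟨-k, -(B ∘ ⇑(finRotate p ^ (-k))), ?_, by push_cast; rfl, ?_, fun x => ?_⟩
    · rw [zpow_neg, ← hg]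
      rfl
    · simp only [Pi.neg_apply, Finset.sum_neg_distrib, Function.comp_apply]
      rw [Equiv.sum_comp]
    · rw [map_neg, conv_comp_zpow, sections_inv, hg, ← zpow_neg]
      exact (hs _).inv

end Exponents

lemma apply_nil_of_mem_levelStab {p k : ℕ} {g : AutT p} (hg : g ∈ levelStab p (k + 1)) :
    g [] = 1 := by
  ext x
  have h := hg (x :: List.replicate k x) (by simp)
  rw [act_cons] at h
  rw [(List.cons.inj h).1]
  rfl

lemma sections_mem_levelStab {p k : ℕ} {g : AutT p} (hg : g ∈ levelStab p (k + 1))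
    (x : Fin p) : sections g x ∈ levelStab p k := by
  intro v hv
  have h := hg (x :: v) (by simp [hv])
  rw [act_cons] at h
  exact (List.cons.inj h).2

lemma intCast_eq_zero_of_finRotate_zpow {p : ℕ} (hp : 2 ≤ p) {k : ℤ}
    (h : finRotate p ^ k = 1) : (k : ZMod p) = 0 := by
  obtain ⟨q, rfl⟩ := Nat.exists_eq_add_of_le' hp
  have hord : orderOf (finRotate (q + 2)) = q + 2 := by
    rw [isCycle_finRotate.orderOf, support_finRotate, Finset.card_univ, Fintype.card_fin]
  rw [ZMod.intCast_zmod_eq_zero_iff_dvd, ← hord]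
  exact orderOf_dvd_iff_zpow_eq_one.2 h

/-- Elements of `st(k + 1)` have trivial `a`-exponent, and their `b`-exponents lie in a
space of codimension at least `k`. -/
lemma exists_exponent_space {p r : ℕ} [Fact p.Prime] {e : Fin r → Fin (p - 1) → ZMod p}
    (he : LinearIndependent (ZMod p) e) (k : ℕ) (hk : k ≤ r) :
    ∃ W : Submodule (ZMod p) (Fin r → ZMod p), Module.finrank (ZMod p) W + k ≤ r ∧
      ∀ g α β, HasExponents e g α β → g ∈ levelStab p (k + 1) → α = 0 ∧ β ∈ W := by
  have hα : ∀ (k : ℕ) (g : AutT p) (l : ℤ), g [] = finRotate p ^ l →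
      g ∈ levelStab p (k + 1) → (l : ZMod p) = 0 := fun k g l hl hg =>
    intCast_eq_zero_of_finRotate_zpow (Fact.out : p.Prime).two_le (hl.symm.trans (apply_nil_of_mem_levelStab hg))
  induction k with
  | zero =>
    refine ⟨⊤, by simp, fun g α β h hg => ⟨?_, Submodule.mem_top⟩⟩
    obtain ⟨l, B, hl, rfl, -, -⟩ := h.exists_sections
    exact hα _ _ _ hl hg
  | succ k ih =>
    obtain ⟨W, hWk, hW⟩ := ih (by omega)
    have key : ∀ g α β, HasExponents e g α β → g ∈ levelStab p (k + 1 + 1) →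
        α = 0 ∧ ∃ B : Fin p → Fin r → ZMod p,
          (∀ y, B y ∈ W) ∧ conv e B = 0 ∧ ∑ y, B y = β := by
      intro g α β h hg
      obtain ⟨l, B, hl, rfl, hB, hs⟩ := h.exists_sections
      have hsec := fun x => hW _ _ _ (hs x) (sections_mem_levelStab hg x)
      exact ⟨hα _ _ _ hl hg, B, fun y => (hsec y).2, funext fun x => (hsec x).1, hB⟩
    by_cases hbot : W = ⊥
    · refine ⟨W, by rw [hbot, finrank_bot]; omega, fun g α β h hg => ?_⟩
      obtain ⟨h0, B, hB, -, rfl⟩ := key g α β h hg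
      exact ⟨h0, sum_mem fun y _ => hB y⟩
    · obtain ⟨W', hlt, hW'⟩ := exists_lt_sum_mem e he hbot
      refine ⟨W', ?_, fun g α β h hg => ?_⟩
      · have := Submodule.finrank_lt_finrank_of_lt hlt
        omega
      · obtain ⟨h0, B, hB, hc, rfl⟩ := key g α β h hg
        exact ⟨h0, hW' B hB hc⟩

/-- A group with a surjection onto the additive group of a vector space over `ZMod p` needs
at least as many generators as the dimension of the space. -/
lemma finrank_le_card_of_closure_eq_top {p : ℕ} [Fact p.Prime] {A X : Type*} [Group A]
    [AddCommGroup X] [Module (ZMod p) X] (f : A →* Multiplicative X)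
    (hf : Function.Surjective f) (S : Finset A) (hS : Subgroup.closure (S : Set A) = ⊤) :
    Module.finrank (ZMod p) X ≤ S.card := by
  classical
  let T : Finset X := S.image fun s => (f s).toAdd
  have hT : Submodule.span (ZMod p) (T : Set X) = ⊤ := by
    refine (Submodule.eq_top_iff').2 fun x => ?_
    obtain ⟨s, hs⟩ := hf (Multiplicative.ofAdd x)
    have hmem : ∀ s : A, (f s).toAdd ∈ Submodule.span (ZMod p) (T : Set X) := by
      intro s
      have hs : s ∈ Subgroup.closure (S : Set A) := hS ▸ Subgroup.mem_top s
      induction hs using Subgroup.closure_induction with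
      | mem s hs => exact Submodule.subset_span (Finset.mem_coe.2 (Finset.mem_image_of_mem _ hs))
      | one => simp
      | mul s t _ _ hs ht => simpa using add_mem hs ht
      | inv s _ hs => simpa using hs
    have := hmem s
    rwa [hs] at this
  calc Module.finrank (ZMod p) X = (T : Set X).finrank (ZMod p) := by
        rw [Set.finrank, hT, finrank_top]
    _ ≤ T.card := finrank_span_finset_le_card T
    _ ≤ S.card := Finset.card_image_le

/-- If the exponents of the elements of `st(n)` lie in `0 × W`, then exponents modulo `W`
define a homomorphism on the `n`-th congruence quotient. -/
lemma exists_exponent_hom {p r n : ℕ} [NeZero p] {e : Fin r → Fin (p - 1) → ZMod p}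
    (W : Submodule (ZMod p) (Fin r → ZMod p))
    (hW : ∀ g α β, HasExponents e g α β → g ∈ levelStab p n → α = 0 ∧ β ∈ W) :
    ∃ f : (multiGGS p e ⧸ stabIn (multiGGS p e) n) →*
        Multiplicative (ZMod p × ((Fin r → ZMod p) ⧸ W)),
      Function.Surjective f := by
  choose α β hαβ using fun g : multiGGS p e => exists_hasExponents g.2
  have huniq : ∀ {g : multiGGS p e} {α' β'}, HasExponents e g.1 α' β' →
      (α g, W.mkQ (β g)) = (α', W.mkQ β') := by
    intro g α' β' h
    have h1 := (hαβ g).mul h.inv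
    rw [mul_inv_cancel] at h1
    have h2 := hW _ _ _ h1 (one_mem _)
    refine Prod.ext (by simpa [← sub_eq_add_neg, sub_eq_zero] using h2.1) ?_
    exact (Submodule.Quotient.eq W).2 (by simpa [← sub_eq_add_neg] using h2.2)
  let f : multiGGS p e →* Multiplicative (ZMod p × ((Fin r → ZMod p) ⧸ W)) :=
    MonoidHom.mk' (fun g => Multiplicative.ofAdd (α g, W.mkQ (β g))) fun g h => by
      rw [huniq (g := g * h) ((hαβ g).mul (hαβ h)), map_add]
      rfl
  refine ⟨QuotientGroup.lift _ f fun g hg => ?_, ?_⟩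
  · have h := hW _ _ _ (hαβ g) hg
    refine congrArg Multiplicative.ofAdd (Prod.ext h.1 ?_)
    exact (Submodule.Quotient.mk_eq_zero W).2 h.2
  · intro y
    obtain ⟨⟨x, q⟩, rfl⟩ := Multiplicative.ofAdd.surjective y
    obtain ⟨v, rfl⟩ := W.mkQ_surjective q
    obtain ⟨g, hg⟩ := exists_hasExponents_of_exponents (e := e) x v
    exact ⟨QuotientGroup.mk ⟨g, hg.mem⟩, congrArg Multiplicative.ofAdd (huniq hg)⟩

end TreeAut.AutT

/-- For a multi-GGS-group `G` and `2 ≤ n ≤ r + 1`, the minimal number of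
generators of `Ḡ_n = (G/st_G(n))^ab` is at least `n`: every finite generating
set of `Ḡ_n` has at least `n` elements. -/
theorem rank_abelianization_quotient_ge
    (p r : ℕ) (hp : p.Prime) (hpodd : Odd p) (hr : 1 ≤ r)
    (e : Fin r → Fin (p - 1) → ZMod p) (he : LinearIndependent (ZMod p) e)
    (n : ℕ) (h2 : 2 ≤ n) (hn : n ≤ r + 1) :
    ∀ S : Finset (Abelianization ((multiGGS p e : Subgroup (AutT p)) ⧸ stabIn (multiGGS p e) n)),
      Subgroup.closure (S : Set (Abelianization ((multiGGS p e : Subgroup (AutT p)) ⧸ stabIn (multiGGS p e) n))) = ⊤ →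
        n ≤ S.card := by
  have : Fact p.Prime := ⟨hp⟩
  intro S hS
  obtain ⟨k, rfl⟩ : ∃ k, n = k + 1 := ⟨n - 1, by omega⟩
  obtain ⟨W, hWk, hW⟩ := exists_exponent_space he k (by omega)
  obtain ⟨f, hf⟩ := exists_exponent_hom W hW
  have hsurj : Function.Surjective (Abelianization.lift f) := fun y => by
    obtain ⟨x, rfl⟩ := hf y
    exact ⟨Abelianization.of x, Abelianization.lift_apply_of f x⟩
  have hcard := finrank_le_card_of_closure_eq_top (p := p) _ hsurj S hS
  have hquot := W.finrank_quotient_add_finrank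
  rw [Module.finrank_prod, Module.finrank_self] at hcard
  rw [Module.finrank_fin_fun] at hquot
  omega
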